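/- Let C be a Grothendieck abelian category and n ≥ 3 an integer. The full subcategory of D(Fun(Ã(n,2), C)) spanned by the objects that vanish at every vanishing position (i, i+1) for 0 ≤ i ≤ n−3 is equivalent to D(Fun([n−1], C)); moreover the equivalence can be chosen so that its underlying functor is triangulated (commutes with shifts and preserves distinguished triangles). (This is the underlying-category instance, for the homotopy derivator of a Grothendieck abelian category, of the main theorem: the equivalence of stable derivators 𝒟^{A(n,2)} ≃ 𝒟^{A_n}.) -/

import Mathlib

/-!
The underlying-category instance of the main theorem `𝒟^{A(n,2)} ≃ 𝒟^{A_n}` for the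
homotopy derivator of a Grothendieck abelian category `C`: the full subcategory of
`D(Fun(Ã(n,2), C))` of objects vanishing at the vanishing positions is equivalent to
`D(Fun([n-1], C))`, via a triangulated equivalence.  We formulate this as the existence
of a fully faithful triangulated functor `D(Fun([n-1], C)) ⥤ D(Fun(Ã(n,2), C))` whose
essential image is exactly the vanishing subcategory.
-/

open CategoryTheory CategoryTheory.Limits

universe v u

/-- The poset `Ã(n,2)`: the full subposet of `{0,…,n-2} × {0,…,n-2}` (componentwise order)
on the pairs `(i,j)` with `|i - j| = 1` together with `(0,0)` and `(n-2,n-2)`. -/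
def Atilde (n : ℕ) : Type :=
  {p : Fin (n - 1) × Fin (n - 1) //
    (p.1.val + 1 = p.2.val ∨ p.2.val + 1 = p.1.val) ∨
      (p.1.val = 0 ∧ p.2.val = 0) ∨ (p.1.val = n - 2 ∧ p.2.val = n - 2)}

instance (n : ℕ) : PartialOrder (Atilde n) :=
  inferInstanceAs (PartialOrder {p : Fin (n - 1) × Fin (n - 1) //
    (p.1.val + 1 = p.2.val ∨ p.2.val + 1 = p.1.val) ∨
      (p.1.val = 0 ∧ p.2.val = 0) ∨ (p.1.val = n - 2 ∧ p.2.val = n - 2)})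

section ExactFunctors

namespace CategoryTheory

universe v₁ v₂ v₃ u₁ u₂ u₃ w₁ w₂ w₃

variable {C₁ : Type u₁} [Category.{v₁} C₁] {C₂ : Type u₂} [Category.{v₂} C₂]
  {C₃ : Type u₃} [Category.{v₃} C₃]

/-- An adjunction between additive functors induces an adjunction on complexes. -/
def Adjunction.mapHomologicalComplex [Preadditive C₁] [Preadditive C₂]
    {L : C₁ ⥤ C₂} {R : C₂ ⥤ C₁} (adj : L ⊣ R) [L.Additive] [R.Additive]
    {ι : Type*} (c : ComplexShape ι) :
    L.mapHomologicalComplex c ⊣ R.mapHomologicalComplex c where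
  unit :=
    { app := fun K =>
        { f := fun i => adj.unit.app (K.X i)
          comm' := fun i j _ => (adj.unit.naturality (K.d i j)).symm }
      naturality := fun _ _ f => by ext i; exact adj.unit.naturality (f.f i) }
  counit :=
    { app := fun K =>
        { f := fun i => adj.counit.app (K.X i)
          comm' := fun i j _ => (adj.counit.naturality (K.d i j)).symm }
      naturality := fun _ _ f => by ext i; exact adj.counit.naturality (f.f i) }
  left_triangle_components K := by ext i; exact adj.left_triangle_components (K.X i)
  right_triangle_components K := by ext i; exact adj.right_triangle_components (K.X i)

variable [Abelian C₁] [Abelian C₂] [Abelian C₃]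
  [HasDerivedCategory.{w₁} C₁] [HasDerivedCategory.{w₂} C₂] [HasDerivedCategory.{w₃} C₃]

/-- An adjunction between exact functors induces an adjunction on derived categories. -/
noncomputable def Adjunction.mapDerivedCategory
    {L : C₁ ⥤ C₂} {R : C₂ ⥤ C₁} (adj : L ⊣ R)
    [L.Additive] [PreservesFiniteLimits L] [PreservesFiniteColimits L]
    [R.Additive] [PreservesFiniteLimits R] [PreservesFiniteColimits R] :
    L.mapDerivedCategory ⊣ R.mapDerivedCategory :=
  letI : CatCommSq (L.mapHomologicalComplex (.up ℤ)) DerivedCategory.Q DerivedCategory.Q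
      L.mapDerivedCategory := ⟨L.mapDerivedCategoryFactors.symm⟩
  letI : CatCommSq (R.mapHomologicalComplex (.up ℤ)) DerivedCategory.Q DerivedCategory.Q
      R.mapDerivedCategory := ⟨R.mapDerivedCategoryFactors.symm⟩
  (adj.mapHomologicalComplex (.up ℤ)).localization
    DerivedCategory.Q (HomologicalComplex.quasiIso C₁ (.up ℤ))
    DerivedCategory.Q (HomologicalComplex.quasiIso C₂ (.up ℤ)) _ _

namespace Functor

section

variable (F : C₁ ⥤ C₂) [F.Additive] [PreservesFiniteLimits F] [PreservesFiniteColimits F]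

/-- Isomorphic exact functors induce isomorphic functors on derived categories. -/
noncomputable def mapDerivedCategoryIso {F G : C₁ ⥤ C₂} (e : F ≅ G)
    [F.Additive] [PreservesFiniteLimits F] [PreservesFiniteColimits F]
    [G.Additive] [PreservesFiniteLimits G] [PreservesFiniteColimits G] :
    F.mapDerivedCategory ≅ G.mapDerivedCategory :=
  Localization.liftNatIso DerivedCategory.Q (HomologicalComplex.quasiIso C₁ (.up ℤ))
    (F.mapHomologicalComplex _ ⋙ DerivedCategory.Q)
    (G.mapHomologicalComplex _ ⋙ DerivedCategory.Q) _ _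
    (isoWhiskerRight (NatIso.mapHomologicalComplex e _) _)

/-- The identity functor induces the identity on the derived category. -/
noncomputable def mapDerivedCategoryId :
    (𝟭 C₁).mapDerivedCategory ≅ 𝟭 (DerivedCategory C₁) :=
  Localization.liftNatIso DerivedCategory.Q (HomologicalComplex.quasiIso C₁ (.up ℤ))
    ((𝟭 C₁).mapHomologicalComplex _ ⋙ DerivedCategory.Q) DerivedCategory.Q _ _
    (isoWhiskerRight (mapHomologicalComplexIdIso C₁ _) _ ≪≫ leftUnitor _)

/-- A composition of exact functors induces the composition on derived categories. -/
noncomputable def mapDerivedCategoryComp {F : C₁ ⥤ C₂} {G : C₂ ⥤ C₃} {H : C₁ ⥤ C₃}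
    (e : F ⋙ G ≅ H)
    [F.Additive] [PreservesFiniteLimits F] [PreservesFiniteColimits F]
    [G.Additive] [PreservesFiniteLimits G] [PreservesFiniteColimits G]
    [H.Additive] [PreservesFiniteLimits H] [PreservesFiniteColimits H] :
    F.mapDerivedCategory ⋙ G.mapDerivedCategory ≅ H.mapDerivedCategory :=
  letI : Localization.Lifting DerivedCategory.Q (HomologicalComplex.quasiIso C₁ (.up ℤ))
      (F.mapHomologicalComplex _ ⋙ G.mapHomologicalComplex _ ⋙ DerivedCategory.Q)
      (F.mapDerivedCategory ⋙ G.mapDerivedCategory) :=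
    ⟨(associator _ _ _).symm ≪≫ isoWhiskerRight F.mapDerivedCategoryFactors _ ≪≫
      associator _ _ _ ≪≫ isoWhiskerLeft _ G.mapDerivedCategoryFactors⟩
  Localization.liftNatIso DerivedCategory.Q (HomologicalComplex.quasiIso C₁ (.up ℤ))
    (F.mapHomologicalComplex _ ⋙ G.mapHomologicalComplex _ ⋙ DerivedCategory.Q)
    (H.mapHomologicalComplex _ ⋙ DerivedCategory.Q) _ _
    ((associator _ _ _).symm ≪≫ isoWhiskerRight (mapHomologicalComplexCompIso e _) _)

lemma nonempty_homologyFunctor_mapDerivedCategory_iso (X : DerivedCategory C₁) (q : ℤ) :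
    Nonempty ((DerivedCategory.homologyFunctor C₂ q).obj (F.mapDerivedCategory.obj X) ≅
      F.obj ((DerivedCategory.homologyFunctor C₁ q).obj X)) := by
  let K := DerivedCategory.Q.objPreimage X
  let e : DerivedCategory.Q.obj K ≅ X := DerivedCategory.Q.objObjPreimageIso X
  refine ⟨(DerivedCategory.homologyFunctor C₂ q).mapIso
    (F.mapDerivedCategory.mapIso e.symm ≪≫ F.mapDerivedCategoryFactors.app K) ≪≫
    (DerivedCategory.homologyFunctorFactors C₂ q).app _ ≪≫ ?_ ≪≫
    F.mapIso (((DerivedCategory.homologyFunctorFactors C₁ q).app K).symm ≪≫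
      (DerivedCategory.homologyFunctor C₁ q).mapIso e)⟩
  exact (K.sc q).mapHomologyIso F

end

end Functor

end CategoryTheory

end ExactFunctors

section Triangulated

namespace CategoryTheory.Functor

open Pretriangulated

open scoped ZeroObject

section

variable {T A B : Type*} [Category* T] [Category* A] [Category* B]

/-- The functor `F` induces a bijection on morphisms from `X` to `Y`. -/
def HomBijective (F : T ⥤ A) (X Y : T) : Prop :=
  Function.Bijective (F.map : (X ⟶ Y) → (F.obj X ⟶ F.obj Y))

lemma homBijective_of_full_faithful (F : T ⥤ A) [F.Full] [F.Faithful] (X Y : T) :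
    F.HomBijective X Y :=
  ⟨F.map_injective, F.map_surjective⟩

lemma homBijective_congr {F G : T ⥤ A} (e : F ≅ G) (X Y : T) :
    F.HomBijective X Y ↔ G.HomBijective X Y := by
  have h : (G.map : (X ⟶ Y) → _) =
      (Iso.homCongr (e.app X) (e.app Y)) ∘ (F.map : (X ⟶ Y) → _) := by
    ext f
    simp
  rw [HomBijective, HomBijective, h, Function.Bijective.of_comp_iff' (Equiv.bijective _)]

lemma homBijective_comp_iff (F : T ⥤ A) (G : A ⥤ B) {X Y : T} (h : F.HomBijective X Y) :
    (F ⋙ G).HomBijective X Y ↔ G.HomBijective (F.obj X) (F.obj Y) :=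
  Function.Bijective.of_comp_iff (G.map : (F.obj X ⟶ F.obj Y) → _) h

lemma homBijective_comp_iff' (F : T ⥤ A) (G : A ⥤ B) {X Y : T}
    (h : G.HomBijective (F.obj X) (F.obj Y)) :
    (F ⋙ G).HomBijective X Y ↔ F.HomBijective X Y :=
  Function.Bijective.of_comp_iff' h (F.map : (X ⟶ Y) → _)

lemma homBijective_iff_of_iso (F : T ⥤ A) {X X' Y Y' : T} (e : X ≅ X') (e' : Y ≅ Y') :
    F.HomBijective X Y ↔ F.HomBijective X' Y' := by
  have h : (F.map : (X' ⟶ Y') → _) ∘ (Iso.homCongr e e') =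
      (Iso.homCongr (F.mapIso e) (F.mapIso e')) ∘ (F.map : (X ⟶ Y) → _) := by
    ext f
    simp
  rw [HomBijective, HomBijective,
    ← Function.Bijective.of_comp_iff _ (Equiv.bijective (Iso.homCongr e e')), h,
    Function.Bijective.of_comp_iff' (Equiv.bijective _)]

lemma homBijective_of_isIso_unit {L : T ⥤ A} {R : A ⥤ T} (adj : L ⊣ R) [IsIso adj.unit]
    (X : T) (Y : A) : R.HomBijective (L.obj X) Y := by
  have h : (fun f => adj.unit.app X ≫ f) ∘ (R.map : (L.obj X ⟶ Y) → _) =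
      adj.homEquiv X Y := by
    ext f
    simp [adj.homEquiv_unit]
  have h' : Function.Bijective (fun f : R.obj (L.obj X) ⟶ R.obj Y => adj.unit.app X ≫ f) :=
    ((asIso (adj.unit.app X)).homFromEquiv (Z := R.obj Y)).symm.bijective
  exact (Function.Bijective.of_comp_iff' h' _).1 (h ▸ Equiv.bijective _)

lemma homBijective_of_isIso_counit {L : T ⥤ A} {R : A ⥤ T} (adj : L ⊣ R) [IsIso adj.counit]
    (X : T) (Y : A) : L.HomBijective X (R.obj Y) := by
  have h : (fun f => f ≫ adj.counit.app Y) ∘ (L.map : (X ⟶ R.obj Y) → _) =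
      (adj.homEquiv X Y).symm := by
    ext f
    simp [adj.homEquiv_counit]
  have h' : Function.Bijective (fun f : L.obj X ⟶ L.obj (R.obj Y) => f ≫ adj.counit.app Y) :=
    ((asIso (adj.counit.app Y)).homToEquiv (Z := L.obj X)).bijective
  exact (Function.Bijective.of_comp_iff' h' _).1 (h ▸ Equiv.bijective _)

lemma homBijective_shift_iff [HasShift T ℤ] [HasShift A ℤ] (F : T ⥤ A) [F.CommShift ℤ]
    (X Y : T) (n : ℤ) : F.HomBijective (X⟦n⟧) (Y⟦n⟧) ↔ F.HomBijective X Y := by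
  rw [← homBijective_comp_iff (shiftFunctor T n) F (homBijective_of_full_faithful _ _ _),
    homBijective_congr (F.commShiftIso n),
    homBijective_comp_iff' F _ (homBijective_of_full_faithful _ _ _)]

end

section

variable {T A B : Type*} [Category* T] [Category* A] [Category* B]
  [HasZeroObject T] [HasShift T ℤ] [Preadditive T] [∀ n : ℤ, (shiftFunctor T n).Additive]
  [Pretriangulated T]
  [HasZeroObject A] [HasShift A ℤ] [Preadditive A] [∀ n : ℤ, (shiftFunctor A n).Additive]
  [Pretriangulated A]
  [HasZeroObject B] [HasShift B ℤ] [Preadditive B] [∀ n : ℤ, (shiftFunctor B n).Additive]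
  [Pretriangulated B]
  (F : T ⥤ A) [F.CommShift ℤ] [F.IsTriangulated]

/-- The objects `X` such that `F` is bijective on morphisms out of `X`. -/
def homBijectiveFrom : ObjectProperty T := fun X => ∀ Y, F.HomBijective X Y

/-- The objects `Y` such that `F` is bijective on morphisms into `Y`. -/
def homBijectiveTo : ObjectProperty T := fun Y => ∀ X, F.HomBijective X Y

instance : F.homBijectiveFrom.IsClosedUnderIsomorphisms where
  of_iso e h Y := (F.homBijective_iff_of_iso e (Iso.refl Y)).1 (h Y)

instance : F.homBijectiveTo.IsClosedUnderIsomorphisms where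
  of_iso e h X := (F.homBijective_iff_of_iso (Iso.refl X) e).1 (h X)

instance : F.homBijectiveFrom.IsStableUnderShift ℤ where
  isStableUnderShiftBy n :=
    { le_shift X h Y :=
        (F.homBijective_iff_of_iso (Iso.refl _) ((shiftEquiv T n).counitIso.app Y)).1
          ((F.homBijective_shift_iff X _ n).2 (h _)) }

instance : F.homBijectiveTo.IsStableUnderShift ℤ where
  isStableUnderShiftBy n :=
    { le_shift Y h X :=
        (F.homBijective_iff_of_iso ((shiftEquiv T n).counitIso.app X) (Iso.refl _)).1
          ((F.homBijective_shift_iff _ Y n).2 (h _)) }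

instance : F.homBijectiveFrom.IsTriangulated where
  exists_zero := by
    refine ⟨0, isZero_zero T,
      fun Y => ⟨fun f g _ => (isZero_zero T).eq_of_src f g, fun f => ⟨0, ?_⟩⟩⟩
    exact (F.map_isZero (isZero_zero T)).eq_of_src _ _
  ext₂' X hX h₁ h₃ := by
    refine ObjectProperty.le_isoClosure _ _ fun Y => ⟨?_, fun φ => ?_⟩
    · refine (injective_iff_map_eq_zero (F.mapAddHom (X := X.obj₂) (Y := Y))).2 fun φ hφ => ?_
      have hφ : F.map φ = 0 := hφ
      obtain ⟨ψ, rfl⟩ := X.yoneda_exact₂ hX φ ((h₁ Y).1 (by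
        rw [F.map_comp, hφ, comp_zero, F.map_zero]))
      have exact₃ : ∀ χ : F.obj X.obj₃ ⟶ F.obj Y, F.map X.mor₂ ≫ χ = 0 →
          ∃ θ, χ = (F.map X.mor₃ ≫ (F.commShiftIso (1 : ℤ)).hom.app X.obj₁) ≫ θ :=
        (F.mapTriangle.obj X).yoneda_exact₃ (F.map_distinguished X hX)
      obtain ⟨θ', hθ'⟩ := exact₃ (F.map ψ) (by rw [← F.map_comp, hφ])
      obtain ⟨θ, hθ⟩ := (F.homBijectiveFrom.le_shift (1 : ℤ) _ h₁ Y).2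
        ((F.commShiftIso (1 : ℤ)).hom.app _ ≫ θ')
      have : ψ = X.mor₃ ≫ θ := (h₃ Y).1 (by rw [F.map_comp, hθ, hθ', Category.assoc])
      rw [this, comp_distTriang_mor_zero₂₃_assoc _ hX, zero_comp]
    · obtain ⟨χ, hχ⟩ := (h₁ Y).2 (F.map X.mor₁ ≫ φ)
      have exact₁ : ∃ δ : X.obj₃⟦(-1 : ℤ)⟧ ⟶ X.obj₁, δ ≫ X.mor₁ = 0 ∧
          ∀ χ : X.obj₁ ⟶ Y, δ ≫ χ = 0 → ∃ φ, χ = X.mor₁ ≫ φ :=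
        ⟨X.invRotate.mor₁, comp_distTriang_mor_zero₁₂ _ (inv_rot_of_distTriang _ hX),
          X.invRotate.yoneda_exact₂ (inv_rot_of_distTriang _ hX)⟩
      obtain ⟨δ, hδ, exact₁⟩ := exact₁
      obtain ⟨φ₁, rfl⟩ := exact₁ χ ((F.homBijectiveFrom.le_shift (-1 : ℤ) _ h₃ Y).1 (by
        rw [F.map_comp, hχ, ← F.map_comp_assoc, hδ, F.map_zero, zero_comp, F.map_zero]))
      have exact₂ : ∀ χ : F.obj X.obj₂ ⟶ F.obj Y, F.map X.mor₁ ≫ χ = 0 →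
          ∃ θ, χ = F.map X.mor₂ ≫ θ :=
        (F.mapTriangle.obj X).yoneda_exact₂ (F.map_distinguished X hX)
      obtain ⟨ψ', hψ'⟩ := exact₂ (φ - F.map φ₁) (by
        rw [Preadditive.comp_sub, ← hχ, F.map_comp, sub_self])
      obtain ⟨ψ, rfl⟩ := (h₃ Y).2 ψ'
      exact ⟨φ₁ + X.mor₂ ≫ ψ, by rw [F.map_add, F.map_comp, ← hψ']; abel⟩

instance : F.homBijectiveTo.IsTriangulated where
  exists_zero := by
    refine ⟨0, isZero_zero T,
      fun Y => ⟨fun f g _ => (isZero_zero T).eq_of_tgt f g, fun f => ⟨0, ?_⟩⟩⟩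
    exact (F.map_isZero (isZero_zero T)).eq_of_tgt _ _
  ext₂' Y hY h₁ h₃ := by
    refine ObjectProperty.le_isoClosure _ _ fun X => ⟨?_, fun φ => ?_⟩
    · refine (injective_iff_map_eq_zero (F.mapAddHom (X := X) (Y := Y.obj₂))).2 fun φ hφ => ?_
      have hφ : F.map φ = 0 := hφ
      obtain ⟨ψ, rfl⟩ := Y.coyoneda_exact₂ hY φ ((h₃ X).1 (by
        rw [F.map_comp, hφ, zero_comp, F.map_zero]))
      have exact₁ : ∃ δ : Y.obj₃⟦(-1 : ℤ)⟧ ⟶ Y.obj₁, δ ≫ Y.mor₁ = 0 ∧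
          ∀ χ : F.obj X ⟶ F.obj Y.obj₁, χ ≫ F.map Y.mor₁ = 0 → ∃ θ, χ = θ ≫ F.map δ :=
        ⟨Y.invRotate.mor₁, comp_distTriang_mor_zero₁₂ _ (inv_rot_of_distTriang _ hY),
          (F.mapTriangle.obj Y.invRotate).coyoneda_exact₂
            (F.map_distinguished _ (inv_rot_of_distTriang _ hY))⟩
      obtain ⟨δ, hδ, exact₁⟩ := exact₁
      obtain ⟨θ', hθ'⟩ := exact₁ (F.map ψ) (by rw [← F.map_comp, hφ])
      obtain ⟨θ, rfl⟩ := (F.homBijectiveTo.le_shift (-1 : ℤ) _ h₃ X).2 θ'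
      have : ψ = θ ≫ δ := (h₁ X).1 (by rw [hθ', F.map_comp])
      rw [this, Category.assoc, hδ, comp_zero]
    · obtain ⟨χ, hχ⟩ := (h₃ X).2 (φ ≫ F.map Y.mor₂)
      obtain ⟨φ₁, rfl⟩ := Y.coyoneda_exact₃ hY χ
        ((F.homBijectiveTo.le_shift (1 : ℤ) _ h₁ X).1 (by
          rw [F.map_comp, hχ, Category.assoc, ← F.map_comp, comp_distTriang_mor_zero₂₃ _ hY,
            F.map_zero, comp_zero, F.map_zero]))
      have exact₂ : ∀ χ : F.obj X ⟶ F.obj Y.obj₂, χ ≫ F.map Y.mor₂ = 0 →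
          ∃ θ, χ = θ ≫ F.map Y.mor₁ :=
        (F.mapTriangle.obj Y).coyoneda_exact₂ (F.map_distinguished Y hY)
      obtain ⟨ψ', hψ'⟩ := exact₂ (φ - F.map φ₁) (by
        rw [Preadditive.sub_comp, ← hχ, F.map_comp, sub_self])
      obtain ⟨ψ, rfl⟩ := (h₁ X).2 ψ'
      exact ⟨φ₁ + ψ ≫ Y.mor₁, by rw [F.map_add, F.map_comp, ← hψ']; abel⟩

/-- A triangulated equivalence admits a triangulated inverse. -/
lemma exists_triangulated_inverse [F.IsEquivalence] :
    ∃ (H : A ⥤ T) (_ : H.CommShift ℤ), H.IsTriangulated ∧ H.IsEquivalence ∧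
      ∀ Y, Nonempty (F.obj (H.obj Y) ≅ Y) := by
  let adj := F.asEquivalence.toAdjunction
  let _ : F.asEquivalence.functor.CommShift ℤ := ‹F.CommShift ℤ›
  let _ := adj.rightAdjointCommShift ℤ
  have := adj.commShift_of_leftAdjoint ℤ
  have : F.asEquivalence.functor.IsTriangulated := ‹F.IsTriangulated›
  exact ⟨F.asEquivalence.inverse, inferInstance, adj.isTriangulated_rightAdjoint, inferInstance,
    fun Y => ⟨F.asEquivalence.counitIso.app Y⟩⟩

/-- A roof of triangulated functors which are bijective on morphisms out of, respectively into,
objects whose images generate yields a triangulated equivalence. -/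
theorem exists_triangulated_equivalence_of_roof (G : T ⥤ B) [G.CommShift ℤ] [G.IsTriangulated]
    (P : ObjectProperty T) (hF : P ≤ F.homBijectiveFrom) (hG : P ≤ G.homBijectiveTo)
    (genF : ∀ Q : ObjectProperty A, Q.IsTriangulated → Q.IsClosedUnderIsomorphisms →
      (∀ X, P X → Q (F.obj X)) → ∀ Y, Q Y)
    (genG : ∀ Q : ObjectProperty B, Q.IsTriangulated → Q.IsClosedUnderIsomorphisms →
      (∀ X, P X → Q (G.obj X)) → ∀ Y, Q Y) :
    ∃ (H : B ⥤ A) (_ : H.CommShift ℤ), H.IsTriangulated ∧ H.IsEquivalence ∧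
      ∀ Y, ∃ X, Nonempty (G.obj X ≅ Y) ∧ Nonempty (F.obj X ≅ H.obj Y) := by
  let S := F.homBijectiveFrom ⊓ G.homBijectiveTo
  have hS : P ≤ S := fun X hX => ⟨hF X hX, hG X hX⟩
  let F' := S.ι ⋙ F
  let G' := S.ι ⋙ G
  have : F'.Faithful := ⟨fun {X Y} f g h => S.ι.map_injective ((X.2.1 Y.1).1 h)⟩
  have : F'.Full := ⟨fun {X Y} f => by
    obtain ⟨g, hg⟩ := (X.2.1 Y.1).2 f
    exact ⟨S.fullyFaithfulι.preimage g, by simpa [F'] using hg⟩⟩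
  have : G'.Faithful := ⟨fun {X Y} f g h => S.ι.map_injective ((Y.2.2 X.1).1 h)⟩
  have : G'.Full := ⟨fun {X Y} f => by
    obtain ⟨g, hg⟩ := (Y.2.2 X.1).2 f
    exact ⟨S.fullyFaithfulι.preimage g, by simpa [G'] using hg⟩⟩
  have : F'.EssSurj := ⟨genF F'.essImage inferInstance inferInstance
    fun X hX => ⟨⟨X, hS X hX⟩, ⟨Iso.refl _⟩⟩⟩
  have : G'.EssSurj := ⟨genG G'.essImage inferInstance inferInstance
    fun X hX => ⟨⟨X, hS X hX⟩, ⟨Iso.refl _⟩⟩⟩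
  have : F'.IsEquivalence := { }
  have : G'.IsEquivalence := { }
  obtain ⟨I, _, _, _, hI⟩ := G'.exists_triangulated_inverse
  exact ⟨I ⋙ F', inferInstance, inferInstance, inferInstance, fun Y =>
    ⟨(I.obj Y).1, hI Y, ⟨Iso.refl _⟩⟩⟩

end

end CategoryTheory.Functor

end Triangulated

section DerivedDiagrams

namespace CategoryTheory

open Pretriangulated

section

variable {A B : Type*} [Category* A] [Category* B]
  [HasZeroObject A] [HasShift A ℤ] [Preadditive A] [∀ n : ℤ, (shiftFunctor A n).Additive]
  [Pretriangulated A]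
  [HasZeroObject B] [HasShift B ℤ] [Preadditive B] [∀ n : ℤ, (shiftFunctor B n).Additive]
  [Pretriangulated B]

lemma Functor.isZero_map_obj₃_of_isIso_map {T : Triangle A} (hT : T ∈ distTriang A)
    (F : A ⥤ B) [F.CommShift ℤ] [F.IsTriangulated] (h : IsIso (F.map T.mor₁)) :
    IsZero (F.obj T.obj₃) :=
  (Triangle.isZero₃_iff_isIso₁ _ (F.map_distinguished T hT)).2 h

/-- The cone of the counit of an adjunction whose unit is invertible is killed by the right
adjoint. -/
lemma Adjunction.exists_triangle_of_isIso_unit {L : A ⥤ B} {R : B ⥤ A} (adj : L ⊣ R)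
    [IsIso adj.unit] [R.CommShift ℤ] [R.IsTriangulated] (Y : B) :
    ∃ (N : B) (f : Y ⟶ N) (g : N ⟶ (L.obj (R.obj Y))⟦(1 : ℤ)⟧),
      Triangle.mk (adj.counit.app Y) f g ∈ distTriang B ∧ IsZero (R.obj N) := by
  obtain ⟨N, f, g, h⟩ := distinguished_cocone_triangle (adj.counit.app Y)
  refine ⟨N, f, g, h, R.isZero_map_obj₃_of_isIso_map h ?_⟩
  exact IsIso.of_isIso_fac_left (f := adj.unit.app (R.obj Y))
    (hh := inferInstanceAs (IsIso (𝟙 (R.obj Y))))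
    (adj.right_triangle_components Y)

/-- The cone of the unit of an adjunction whose counit is invertible is killed by the left
adjoint. -/
lemma Adjunction.exists_triangle_of_isIso_counit {L : A ⥤ B} {R : B ⥤ A} (adj : L ⊣ R)
    [IsIso adj.counit] [L.CommShift ℤ] [L.IsTriangulated] (Y : A) :
    ∃ (N : A) (f : R.obj (L.obj Y) ⟶ N) (g : N ⟶ Y⟦(1 : ℤ)⟧),
      Triangle.mk (adj.unit.app Y) f g ∈ distTriang A ∧ IsZero (L.obj N) := by
  obtain ⟨N, f, g, h⟩ := distinguished_cocone_triangle (adj.unit.app Y)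
  refine ⟨N, f, g, h, L.isZero_map_obj₃_of_isIso_map h ?_⟩
  exact IsIso.of_isIso_fac_right (f := adj.counit.app (L.obj Y))
    (hh := inferInstanceAs (IsIso (𝟙 (L.obj Y))))
    (adj.left_triangle_components Y)

end

lemma ShortComplex.Exact.isZero_obj_X₂ {C : Type*} [Category* C] [Abelian C]
    {J : Type*} [Category* J] {S : ShortComplex (J ⥤ C)} (hS : S.Exact) (p : J)
    (h₁ : IsZero (S.X₁.obj p)) (h₃ : IsZero (S.X₃.obj p)) : IsZero (S.X₂.obj p) :=
  (ShortComplex.Exact.map hS ((evaluation J C).obj p)).isZero_X₂ (h₁.eq_of_src _ _)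
    (h₃.eq_of_tgt _ _)

end CategoryTheory

namespace DerivedCategory

open Pretriangulated

open scoped ZeroObject

universe w₁ w₂ w₃ v₁ v₂ v₃ v₄ u₁ u₂ u₃ u₄

variable {C : Type u} [Category.{v} C] [Abelian C]
  {J : Type u₁} [Category.{v₁} J] {K : Type u₂} [Category.{v₂} K] {M : Type u₃} [Category.{v₃} M]
  [HasDerivedCategory.{w₁} (J ⥤ C)] [HasDerivedCategory.{w₂} (K ⥤ C)]
  [HasDerivedCategory.{w₃} (M ⥤ C)]

/-- An object of the derived category of diagrams vanishes at `p` if all its homology diagrams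
do. -/
def VanishesAt (X : DerivedCategory (J ⥤ C)) (p : J) : Prop :=
  ∀ q : ℤ, IsZero (((homologyFunctor (J ⥤ C) q).obj X).obj p)

lemma vanishesAt_iff_of_iso {X Y : DerivedCategory (J ⥤ C)} (e : X ≅ Y) (p : J) :
    X.VanishesAt p ↔ Y.VanishesAt p :=
  forall_congr' fun q => (((homologyFunctor (J ⥤ C) q).mapIso e).app p).isZero_iff

lemma vanishesAt_of_isZero {X : DerivedCategory (J ⥤ C)} (h : IsZero X) (p : J) :
    X.VanishesAt p :=
  fun q => ((evaluation J C).obj p).map_isZero ((homologyFunctor (J ⥤ C) q).map_isZero h)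

lemma isZero_of_vanishesAt {X : DerivedCategory (J ⥤ C)} (h : ∀ p, X.VanishesAt p) :
    IsZero X := by
  have h' : ∀ q, IsZero ((homologyFunctor (J ⥤ C) q).obj X) :=
    fun q => Functor.isZero _ fun p => h p q
  have : IsIso (0 : X ⟶ 0) := by
    rw [isIso_iff]
    exact fun q => (h' q).isIso
      ((homologyFunctor (J ⥤ C) q).map_isZero (isZero_zero _)) _
  exact (isZero_zero _).of_iso (asIso (0 : X ⟶ 0))

lemma vanishesAt_obj₃ {T : Triangle (DerivedCategory (J ⥤ C))} (hT : T ∈ distTriang _) {p : J}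
    (h₁ : T.obj₁.VanishesAt p) (h₂ : T.obj₂.VanishesAt p) : T.obj₃.VanishesAt p :=
  fun q => (HomologySequence.exact₃ T hT q (q + 1) rfl).isZero_obj_X₂ p
    (h₂ q) (h₁ (q + 1))

variable (C) in
/-- Restriction of derived diagrams along a functor. -/
noncomputable abbrev restr (u : J ⥤ K) : DerivedCategory (K ⥤ C) ⥤ DerivedCategory (J ⥤ C) :=
  ((Functor.whiskeringLeft J K C).obj u).mapDerivedCategory

lemma vanishesAt_restr_iff (u : J ⥤ K) (X : DerivedCategory (K ⥤ C)) (p : J) :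
    ((restr C u).obj X).VanishesAt p ↔ X.VanishesAt (u.obj p) :=
  forall_congr' fun q => ((((Functor.whiskeringLeft J K C).obj
    u).nonempty_homologyFunctor_mapDerivedCategory_iso X q).some.app p).isZero_iff

variable (C) in
/-- Restriction is compatible with composition. -/
noncomputable def restrComp {u : J ⥤ K} {v : K ⥤ M} {w : J ⥤ M} (e : u ⋙ v ≅ w) :
    restr C v ⋙ restr C u ≅ restr C w :=
  Functor.mapDerivedCategoryComp
    (F := (Functor.whiskeringLeft K M C).obj v) (G := (Functor.whiskeringLeft J K C).obj u)
    ((Functor.whiskeringLeft J M C).mapIso e)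

variable (C) in
/-- Restriction along the identity. -/
noncomputable def restrId : restr C (𝟭 J) ≅ 𝟭 (DerivedCategory (J ⥤ C)) :=
  Functor.mapDerivedCategoryIso (Iso.refl _) ≪≫ Functor.mapDerivedCategoryId

variable (C) in
/-- Restriction functors along adjoint functors are adjoint. -/
noncomputable def restrAdj {u : J ⥤ K} {v : K ⥤ J} (adj : u ⊣ v) : restr C v ⊣ restr C u :=
  (adj.whiskerLeft C).mapDerivedCategory

lemma isIso_unit_restrAdj {u : J ⥤ K} {v : K ⥤ J} (adj : u ⊣ v) (e : u ⋙ v ≅ 𝟭 J) :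
    IsIso (restrAdj C adj).unit :=
  (restrAdj C adj).isIso_unit_of_iso (restrComp C e ≪≫ restrId C)

lemma isIso_counit_restrAdj {u : J ⥤ K} {v : K ⥤ J} (adj : u ⊣ v) (e : v ⋙ u ≅ 𝟭 K) :
    IsIso (restrAdj C adj).counit :=
  (restrAdj C adj).isIso_counit_of_iso (restrComp C e ≪≫ restrId C)

lemma homBijective_restr_of_adjunction_left {α : J ⥤ K} {g : K ⥤ M} {s : M ⥤ J}
    (adj : s ⋙ α ⊣ g) (adj' : s ⊣ α ⋙ g) (e : s ⋙ α ⋙ g ≅ 𝟭 M)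
    (W : DerivedCategory (M ⥤ C)) (Y : DerivedCategory (K ⥤ C)) :
    (restr C α).HomBijective ((restr C g).obj W) Y := by
  have := isIso_unit_restrAdj (C := C) adj e
  have := isIso_unit_restrAdj (C := C) adj' e
  refine (Functor.homBijective_comp_iff' _ (restr C s) ?_).1
    ((Functor.homBijective_congr (restrComp C (Iso.refl _)) _ _).2
      (Functor.homBijective_of_isIso_unit (restrAdj C adj) W Y))
  exact (Functor.homBijective_iff_of_iso _ ((restrComp C (Iso.refl _)).app W) (Iso.refl _)).2
    (Functor.homBijective_of_isIso_unit (restrAdj C adj') W _)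

lemma homBijective_restr_of_adjunction_right {β : J ⥤ K} {g : K ⥤ M} {s : M ⥤ J}
    (adj : g ⊣ s ⋙ β) (adj' : β ⋙ g ⊣ s) (e : s ⋙ β ⋙ g ≅ 𝟭 M)
    (W : DerivedCategory (M ⥤ C)) (Y : DerivedCategory (K ⥤ C)) :
    (restr C β).HomBijective Y ((restr C g).obj W) := by
  have := isIso_counit_restrAdj (C := C) adj e
  have := isIso_counit_restrAdj (C := C) adj' e
  refine (Functor.homBijective_comp_iff' _ (restr C s) ?_).1
    ((Functor.homBijective_congr (restrComp C (Iso.refl _)) _ _).2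
      (Functor.homBijective_of_isIso_counit (restrAdj C adj) Y W))
  exact (Functor.homBijective_iff_of_iso _ (Iso.refl _) ((restrComp C (Iso.refl _)).app W)).2
    (Functor.homBijective_of_isIso_counit (restrAdj C adj') _ W)

/-- Two coreflections of `J` onto `M` whose sections cover `J` generate the derived diagrams of
shape `J`. -/
lemma generates_of_coreflections {s₁ s₂ : M ⥤ J} {h₁ h₂ : J ⥤ M} (adj₁ : s₁ ⊣ h₁)
    (adj₂ : s₂ ⊣ h₂) (e₁ : s₁ ⋙ h₁ ≅ 𝟭 M) (e₂ : s₂ ⋙ h₂ ≅ 𝟭 M)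
    (cover : ∀ a : J, (∃ x, s₂.obj x = a) ∨
      (∃ x, s₁.obj x = a) ∧ ∃ x, s₁.obj x = s₂.obj (h₂.obj a))
    (Q : ObjectProperty (DerivedCategory (J ⥤ C))) [Q.IsTriangulated]
    [Q.IsClosedUnderIsomorphisms] (hQ₁ : ∀ W, Q ((restr C h₁).obj W))
    (hQ₂ : ∀ W, Q ((restr C h₂).obj W)) (Y : DerivedCategory (J ⥤ C)) : Q Y := by
  have := isIso_unit_restrAdj (C := C) adj₁ e₁
  have := isIso_unit_restrAdj (C := C) adj₂ e₂
  obtain ⟨N₁, f₁, g₁, hT₁, hN₁⟩ := (restrAdj C adj₁).exists_triangle_of_isIso_unit Y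
  obtain ⟨N₂, f₂, g₂, hT₂, hN₂⟩ := (restrAdj C adj₂).exists_triangle_of_isIso_unit N₁
  have van₁ (x) : N₁.VanishesAt (s₁.obj x) :=
    (vanishesAt_restr_iff _ _ _).1 (vanishesAt_of_isZero hN₁ x)
  have zero : IsZero N₂ := isZero_of_vanishesAt fun a => by
    obtain ⟨x, rfl⟩ | ⟨⟨x, rfl⟩, y, hy⟩ := cover a
    · exact (vanishesAt_restr_iff _ _ _).1 (vanishesAt_of_isZero hN₂ x)
    · refine vanishesAt_obj₃ hT₂ ?_ (van₁ x)
      refine (vanishesAt_restr_iff _ _ _).2 ((vanishesAt_restr_iff _ _ _).2 ?_)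
      exact hy ▸ van₁ y
  exact Q.ext_of_isTriangulatedClosed₂ _ hT₁ (hQ₁ _)
    (Q.ext_of_isTriangulatedClosed₂ _ hT₂ (hQ₂ _) (Q.prop_of_isZero zero))

/-- Two reflections of `J` onto `M` whose sections cover `J` generate the derived diagrams of
shape `J`. -/
lemma generates_of_reflections {s₁ s₂ : M ⥤ J} {h₁ h₂ : J ⥤ M} (adj₁ : h₁ ⊣ s₁)
    (adj₂ : h₂ ⊣ s₂) (e₁ : s₁ ⋙ h₁ ≅ 𝟭 M) (e₂ : s₂ ⋙ h₂ ≅ 𝟭 M)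
    (cover : ∀ a : J, (∃ x, s₂.obj x = a) ∨
      (∃ x, s₁.obj x = a) ∧ ∃ x, s₁.obj x = s₂.obj (h₂.obj a))
    (Q : ObjectProperty (DerivedCategory (J ⥤ C))) [Q.IsTriangulated]
    [Q.IsClosedUnderIsomorphisms] (hQ₁ : ∀ W, Q ((restr C h₁).obj W))
    (hQ₂ : ∀ W, Q ((restr C h₂).obj W)) (Y : DerivedCategory (J ⥤ C)) : Q Y := by
  have := isIso_counit_restrAdj (C := C) adj₁ e₁
  have := isIso_counit_restrAdj (C := C) adj₂ e₂
  obtain ⟨N₁, f₁, g₁, hT₁, hN₁⟩ := (restrAdj C adj₁).exists_triangle_of_isIso_counit Y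
  obtain ⟨N₂, f₂, g₂, hT₂, hN₂⟩ := (restrAdj C adj₂).exists_triangle_of_isIso_counit N₁
  have van₁ (x) : N₁.VanishesAt (s₁.obj x) :=
    (vanishesAt_restr_iff _ _ _).1 (vanishesAt_of_isZero hN₁ x)
  have zero : IsZero N₂ := isZero_of_vanishesAt fun a => by
    obtain ⟨x, rfl⟩ | ⟨⟨x, rfl⟩, y, hy⟩ := cover a
    · exact (vanishesAt_restr_iff _ _ _).1 (vanishesAt_of_isZero hN₂ x)
    · refine vanishesAt_obj₃ hT₂ (van₁ x) ?_
      refine (vanishesAt_restr_iff _ _ _).2 ((vanishesAt_restr_iff _ _ _).2 ?_)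
      exact hy ▸ van₁ y
  exact Q.ext_of_isTriangulatedClosed₁ _ hT₁ (hQ₁ _)
    (Q.ext_of_isTriangulatedClosed₁ _ hT₂ (hQ₂ _) (Q.prop_of_isZero zero))

end DerivedCategory

end DerivedDiagrams

section VanishingSubcategories

namespace DerivedCategory

open Pretriangulated

universe w₁ w₂ w₃ w₄ w₅ v₁ v₂ v₃ v₄ v₅ u₁ u₂ u₃ u₄ u₅

variable {C : Type u} [Category.{v} C] [Abelian C]

/-- The full subcategory of derived diagrams of shape `J` which vanish at `V` is the essential
image of a fully faithful triangulated functor from the derived category of `E`. -/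
def ModelsVanishing (E : Type u₁) [Category.{v₁} E] [Abelian E] [HasDerivedCategory.{w₁} E]
    {J : Type u₂} [Category.{v₂} J] [HasDerivedCategory.{w₂} (J ⥤ C)] (V : Set J) : Prop :=
  ∃ (F : DerivedCategory E ⥤ DerivedCategory (J ⥤ C)) (_ : F.CommShift ℤ),
    F.IsTriangulated ∧ F.Full ∧ F.Faithful ∧
      ∀ X, (∃ Y, Nonempty (F.obj Y ≅ X)) ↔ ∀ p ∈ V, X.VanishesAt p

section

variable {E : Type u₁} [Category.{v₁} E] [Abelian E] [HasDerivedCategory.{w₁} E]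
  {A : Type u₂} [Category.{v₂} A] [HasDerivedCategory.{w₂} (A ⥤ C)]
  {B : Type u₃} [Category.{v₃} B] [HasDerivedCategory.{w₃} (B ⥤ C)]
  {K : Type u₄} [Category.{v₄} K] [HasDerivedCategory.{w₄} (K ⥤ C)]
  {M : Type u₅} [Category.{v₅} M] [HasDerivedCategory.{w₅} (M ⥤ C)]

lemma modelsVanishing_self (J : Type u₂) [Category.{v₂} J] [HasDerivedCategory.{w₂} (J ⥤ C)] :
    ModelsVanishing (C := C) (J ⥤ C) (∅ : Set J) :=
  ⟨𝟭 _, inferInstance, inferInstance, inferInstance, inferInstance,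
    fun X => ⟨fun _ _ h => h.elim, fun _ => ⟨X, ⟨Iso.refl _⟩⟩⟩⟩

/-- Vanishing subcategories can be transported along a roof `A ⥤ K`, `B ⥤ K` of diagram shapes
whose common value `K` carries two reflections to `M` which are compatible with `A` and `B`. -/
theorem ModelsVanishing.of_roof {VA : Set A} {VB : Set B} (hB : ModelsVanishing (C := C) E VB)
    (α : A ⥤ K) (β : B ⥤ K) (g : Bool → K ⥤ M) (s : Bool → M ⥤ A) (r : Bool → M ⥤ B)
    (sα : ∀ τ, s τ ⋙ α ⊣ g τ) (sα' : ∀ τ, s τ ⊣ α ⋙ g τ) (es : ∀ τ, s τ ⋙ α ⋙ g τ ≅ 𝟭 M)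
    (rβ : ∀ τ, g τ ⊣ r τ ⋙ β) (rβ' : ∀ τ, β ⋙ g τ ⊣ r τ) (er : ∀ τ, r τ ⋙ β ⋙ g τ ≅ 𝟭 M)
    (coverA : ∀ a : A, (∃ x, (s true).obj x = a) ∨ (∃ x, (s false).obj x = a) ∧
      ∃ x, (s false).obj x = (s true).obj ((g true).obj (α.obj a)))
    (coverB : ∀ b : B, (∃ x, (r true).obj x = b) ∨ (∃ x, (r false).obj x = b) ∧
      ∃ x, (r false).obj x = (r true).obj ((g true).obj (β.obj b)))
    (hV : α.obj '' VA = β.obj '' VB) :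
    ModelsVanishing (C := C) E VA := by
  obtain ⟨F, _, _, _, _, hF⟩ := hB
  obtain ⟨H, _, _, _, hH⟩ := (restr C α).exists_triangulated_equivalence_of_roof (restr C β)
    (fun X => ∃ τ W, X = (restr C (g τ)).obj W)
    (by
      rintro _ ⟨τ, W, rfl⟩ Y
      exact homBijective_restr_of_adjunction_left (sα τ) (sα' τ) (es τ) W Y)
    (by
      rintro _ ⟨τ, W, rfl⟩ Y
      exact homBijective_restr_of_adjunction_right (rβ τ) (rβ' τ) (er τ) W Y)
    (fun Q _ _ hQ => generates_of_coreflections (sα' false) (sα' true) (es false) (es true)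
      coverA Q
      (fun W => Q.prop_of_iso ((restrComp C (Iso.refl _)).app W) (hQ _ ⟨_, W, rfl⟩))
      (fun W => Q.prop_of_iso ((restrComp C (Iso.refl _)).app W) (hQ _ ⟨_, W, rfl⟩)))
    (fun Q _ _ hQ => generates_of_reflections (rβ' false) (rβ' true) (er false) (er true)
      coverB Q
      (fun W => Q.prop_of_iso ((restrComp C (Iso.refl _)).app W) (hQ _ ⟨_, W, rfl⟩))
      (fun W => Q.prop_of_iso ((restrComp C (Iso.refl _)).app W) (hQ _ ⟨_, W, rfl⟩)))
  have key (Y) : (∀ a ∈ VA, (H.obj Y).VanishesAt a) ↔ ∀ b ∈ VB, Y.VanishesAt b := by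
    obtain ⟨X, ⟨e⟩, ⟨e'⟩⟩ := hH Y
    simp only [← vanishesAt_iff_of_iso e, ← vanishesAt_iff_of_iso e', vanishesAt_restr_iff]
    rw [← Set.forall_mem_image (p := X.VanishesAt), hV, Set.forall_mem_image]
  refine ⟨F ⋙ H, inferInstance, inferInstance, inferInstance, inferInstance, fun X => ?_⟩
  have hX : (∀ a ∈ VA, X.VanishesAt a) ↔ ∀ b ∈ VB, (H.objPreimage X).VanishesAt b := by
    rw [← key]
    simp only [vanishesAt_iff_of_iso (H.objObjPreimageIso X)]
  rw [hX, ← hF]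
  exact ⟨fun ⟨Y, ⟨e⟩⟩ => ⟨Y, ⟨H.preimageIso (e ≪≫ (H.objObjPreimageIso X).symm)⟩⟩,
    fun ⟨Y, ⟨e⟩⟩ => ⟨Y, ⟨H.mapIso e ≪≫ H.objObjPreimageIso X⟩⟩⟩

end

lemma isZero_lan_obj_obj {C : Type u} [Category.{v} C] [HasColimits C] [HasZeroMorphisms C]
    {J K : Type} [Category.{0} J] [Category.{0} K] (j : J ⥤ K) (F : J ⥤ C) (p : K)
    [IsEmpty (CostructuredArrow j p)] :
    IsZero ((j.lan.obj F).obj p) := by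
  refine IsZero.of_iso ?_ (j.leftKanExtensionObjIsoColimit F p)
  rw [IsZero.iff_id_eq_zero]
  exact colimit.hom_ext fun x => isEmptyElim x

section

variable {J K : Type} [Category.{0} J] [Category.{0} K] [HasColimits C]
  (j : J ⥤ K) [j.Full] [j.Faithful]

instance : (j.lan : (J ⥤ C) ⥤ _).Additive := (j.lanAdjunction C).left_adjoint_additive

instance : PreservesFiniteColimits (j.lan : (J ⥤ C) ⥤ _) :=
  have := (j.lanAdjunction C).leftAdjoint_preservesColimits
  inferInstance

lemma preservesFiniteLimits_lan
    (hj : ∀ p, (∃ x, j.obj x = p) ∨ IsEmpty (CostructuredArrow j p)) :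
    PreservesFiniteLimits (j.lan : (J ⥤ C) ⥤ _) where
  preservesFiniteLimits L _ _ := by
    refine preservesLimitsOfShape_of_evaluation _ _ fun p => ?_
    obtain ⟨x, rfl⟩ | h := hj p
    · let e : (evaluation J C).obj x ≅ j.lan ⋙ (evaluation K C).obj (j.obj x) :=
        Functor.isoWhiskerRight (asIso (j.lanAdjunction C).unit) ((evaluation J C).obj x)
      exact preservesLimitsOfShape_of_natIso e
    · exact Functor.preservesLimitsOfShape_of_isZero _
        (Functor.isZero _ fun F => isZero_lan_obj_obj j F p) _

/-- Extension by zero along a cosieve inclusion. -/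
theorem ModelsVanishing.of_cosieve {E : Type u₁} [Category.{v₁} E] [Abelian E]
    [HasDerivedCategory.{w₁} E] [HasDerivedCategory.{w₂} (J ⥤ C)]
    [HasDerivedCategory.{w₃} (K ⥤ C)] {V : Set J} {V' : Set K}
    (h : ModelsVanishing (C := C) E V)
    (hj : ∀ p, ((∃ x, j.obj x = p) ∧ ∀ x, j.obj x = p → (p ∈ V' ↔ x ∈ V)) ∨
      (IsEmpty (CostructuredArrow j p) ∧ p ∈ V')) :
    ModelsVanishing (C := C) E V' := by
  have := preservesFiniteLimits_lan (C := C) j fun p => (hj p).imp And.left And.left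
  obtain ⟨F, _, _, _, _, hF⟩ := h
  let adj := (j.lanAdjunction C).mapDerivedCategory
  have : IsIso adj.unit := adj.isIso_unit_of_iso
    (Functor.mapDerivedCategoryComp (asIso (j.lanAdjunction C).unit).symm ≪≫
      Functor.mapDerivedCategoryId)
  have := adj.fullyFaithfulLOfIsIsoUnit.full
  have := adj.fullyFaithfulLOfIsIsoUnit.faithful
  have vanish (Y : DerivedCategory (J ⥤ C)) (p) (hp : IsEmpty (CostructuredArrow j p)) :
      (j.lan.mapDerivedCategory.obj Y).VanishesAt p := fun q =>
    (isZero_lan_obj_obj j _ p).of_iso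
      ((j.lan.nonempty_homologyFunctor_mapDerivedCategory_iso Y q).some.app p)
  refine ⟨F ⋙ j.lan.mapDerivedCategory, inferInstance, inferInstance, inferInstance,
    inferInstance, fun X => ⟨?_, fun hX => ?_⟩⟩
  · rintro ⟨Y, ⟨e⟩⟩ p hp
    rw [← vanishesAt_iff_of_iso e]
    obtain ⟨⟨x, rfl⟩, hx⟩ | ⟨h, -⟩ := hj p
    · rw [← vanishesAt_restr_iff]
      exact (vanishesAt_iff_of_iso ((asIso adj.unit).app (F.obj Y)) x).1
        ((hF _).1 ⟨Y, ⟨Iso.refl _⟩⟩ x ((hx x rfl).1 hp))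
    · exact vanish _ _ h
  · obtain ⟨Y, ⟨e⟩⟩ := (hF ((restr C j).obj X)).2 fun x hx => by
      rw [vanishesAt_restr_iff]
      refine hX _ ?_
      obtain ⟨-, h⟩ | ⟨-, h⟩ := hj (j.obj x)
      exacts [(h x rfl).2 hx, h]
    obtain ⟨N, f, g, hT, hN⟩ := adj.exists_triangle_of_isIso_unit X
    have zero : IsZero N := isZero_of_vanishesAt fun p => by
      obtain ⟨⟨x, rfl⟩, -⟩ | ⟨h, hp⟩ := hj p
      · exact (vanishesAt_restr_iff _ _ _).1 (vanishesAt_of_isZero hN x)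
      · exact vanishesAt_obj₃ hT (vanish _ _ h) (hX _ hp)
    have : IsIso (adj.counit.app X) := (Triangle.isZero₃_iff_isIso₁ _ hT).1 zero
    exact ⟨Y, ⟨j.lan.mapDerivedCategory.mapIso e ≪≫ asIso (adj.counit.app X)⟩⟩

end

end DerivedCategory

end VanishingSubcategories

section DoubledChains

/-- A chain of length `N` in which the levels satisfying `s` are doubled. The two elements of a
doubled level are incomparable, and are distinguished by their `side`. -/
@[ext]
structure DoubledChain (N : ℕ) (s : ℕ → Prop) : Type where
  /-- The level of an element. -/
  level : ℕ
  /-- The side of an element, which is `0` or `1`. -/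
  side : ℕ
  level_lt : level < N
  side_eq : side = 0 ∨ side = 1 ∧ s level

namespace DoubledChain

instance (N : ℕ) (s : ℕ → Prop) : PartialOrder (DoubledChain N s) where
  le a b := a.level < b.level ∨ a.level = b.level ∧ a.side = b.side
  le_refl _ := Or.inr ⟨rfl, rfl⟩
  le_trans _ _ _ _ _ := by omega
  le_antisymm a b _ _ := by ext <;> omega

variable {N : ℕ} {s : ℕ → Prop}

lemma le_def {a b : DoubledChain N s} :
    a ≤ b ↔ a.level < b.level ∨ a.level = b.level ∧ a.side = b.side := Iff.rfl

lemma eq_iff {a b : DoubledChain N s} : a = b ↔ a.level = b.level ∧ a.side = b.side :=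
  DoubledChain.ext_iff

/-- The inclusion of the original chain. -/
def ofFin (N : ℕ) (s : ℕ → Prop) : Fin N ↪o DoubledChain N s :=
  OrderEmbedding.ofMapLEIff (fun x => ⟨x, 0, x.2, Or.inl rfl⟩) fun a b => by
    rw [le_def, Fin.le_def]
    dsimp
    omega

/-- The map of doubled chains induced by a map of levels. -/
def reindex {N' : ℕ} {s' : ℕ → Prop} (f : ℕ → ℕ) (hf : StrictMono f)
    (hlt : ∀ j, j < N → f j < N') (hs : ∀ j, s j → s' (f j)) :
    DoubledChain N s ↪o DoubledChain N' s' :=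
  OrderEmbedding.ofMapLEIff
    (fun x => ⟨f x.level, x.side, hlt _ x.level_lt, x.side_eq.imp id fun h => ⟨h.1, hs _ h.2⟩⟩)
    fun _ _ => by simp [le_def, hf.lt_iff_lt, hf.injective.eq_iff]

section Slide

variable (N s) (i : ℕ)

/-- The doubled chain with an additional doubled level `i`. -/
abbrev Insert := DoubledChain N (fun j => s j ∨ j = i)

/-- A doubled chain with one additional level, containing both `Insert N s i` and
`Insert N s (i + 1)` if the levels `i` and `i + 1` are not doubled. -/
abbrev Roof := DoubledChain (N + 1)
  (fun j => (j < i ∧ s j) ∨ j = i + 1 ∨ (i + 3 ≤ j ∧ s (j - 1)))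

variable {N s i}

/-- The inclusion of the chain doubled at level `i + 1` in the roof. -/
def upperEmb (h₀ : ¬ s i) (h₁ : ¬ s (i + 1)) : Insert N s (i + 1) ↪o Roof N s i :=
  reindex (fun j => if j ≤ i + 1 then j else j + 1)
    (fun a b h => by dsimp only; split_ifs <;> omega)
    (fun j h => by split_ifs <;> omega)
    (fun j h => by
      obtain h | rfl := h
      · have : j ≠ i := fun e => h₀ (e ▸ h)
        have : j ≠ i + 1 := fun e => h₁ (e ▸ h)
        split_ifs
        · exact Or.inl ⟨by omega, h⟩
        · exact Or.inr (Or.inr ⟨by omega, h⟩)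
      · simp)

/-- The inclusion of the chain doubled at level `i` in the roof. -/
def lowerEmb (h₀ : ¬ s i) (h₁ : ¬ s (i + 1)) : Insert N s i ↪o Roof N s i :=
  reindex (fun j => if j < i then j else j + 1)
    (fun a b h => by dsimp only; split_ifs <;> omega)
    (fun j h => by split_ifs <;> omega)
    (fun j h => by
      obtain h | rfl := h
      · have : j ≠ i := fun e => h₀ (e ▸ h)
        have : j ≠ i + 1 := fun e => h₁ (e ▸ h)
        split_ifs
        · exact Or.inl ⟨by omega, h⟩
        · exact Or.inr (Or.inr ⟨by omega, h⟩)
      · simp)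

/-- The section of the doubled chains over the original one which passes through side `k` at
level `i`. -/
def sect (k : ℕ) (hk : k ≤ 1) : DoubledChain N s →o Insert N s i where
  toFun x := ⟨x.level, if x.level = i then k else x.side, x.level_lt, by
    have := x.side_eq
    split_ifs with h
    · simp only [h, or_true, and_true]
      omega
    · exact this.imp id fun h => ⟨h.1, Or.inl h.2⟩⟩
  monotone' a b h := by
    rw [le_def] at h ⊢
    dsimp only
    split_ifs <;> omega

/-- The retraction of the roof which identifies the levels `i` and `i + 1`, except on side `k`
of the level `i + 1`, which is identified with level `i + 2`. -/
def retr (k : ℕ) (hi : i + 1 < N) : Roof N s i →o DoubledChain N s where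
  toFun x :=
    ⟨if x.level ≤ i then x.level else if x.level = i + 1 then (if x.side = k then i + 1 else i)
      else x.level - 1, if x.level = i + 1 then 0 else x.side,
      by have := x.level_lt; split_ifs <;> omega,
      by
        obtain h | ⟨h, h' | h' | h'⟩ := x.side_eq
        · simp [h]
        · have : x.level ≠ i + 1 := by omega
          simp [this, h'.1.le, h, h'.2]
        · simp [h']
        · have : x.level ≠ i + 1 := by omega
          have : ¬ x.level ≤ i := by omega
          simp [*]⟩
  monotone' a b h := by
    have := a.side_eq
    have := b.side_eq
    have ha : a.side = 1 → a.level ≠ i ∧ a.level ≠ i + 2 := by omega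
    have hb : b.side = 1 → b.level ≠ i ∧ b.level ≠ i + 2 := by omega
    rw [le_def] at h ⊢
    dsimp only
    split_ifs <;> omega

lemma upperEmb_level (h₀ : ¬ s i) (h₁ : ¬ s (i + 1)) (x : Insert N s (i + 1)) :
    (upperEmb h₀ h₁ x).level = if x.level ≤ i + 1 then x.level else x.level + 1 := rfl

lemma upperEmb_side (h₀ : ¬ s i) (h₁ : ¬ s (i + 1)) (x : Insert N s (i + 1)) :
    (upperEmb h₀ h₁ x).side = x.side := rfl

lemma lowerEmb_level (h₀ : ¬ s i) (h₁ : ¬ s (i + 1)) (x : Insert N s i) :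
    (lowerEmb h₀ h₁ x).level = if x.level < i then x.level else x.level + 1 := rfl

lemma lowerEmb_side (h₀ : ¬ s i) (h₁ : ¬ s (i + 1)) (x : Insert N s i) :
    (lowerEmb h₀ h₁ x).side = x.side := rfl

lemma sect_level (k : ℕ) (hk : k ≤ 1) (x : DoubledChain N s) :
    (sect (i := i) k hk x).level = x.level := rfl

lemma sect_side (k : ℕ) (hk : k ≤ 1) (x : DoubledChain N s) :
    (sect (i := i) k hk x).side = if x.level = i then k else x.side := rfl

lemma retr_level (k : ℕ) (hi : i + 1 < N) (x : Roof N s i) :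
    (retr k hi x).level = if x.level ≤ i then x.level
      else if x.level = i + 1 then (if x.side = k then i + 1 else i) else x.level - 1 := rfl

lemma retr_side (k : ℕ) (hi : i + 1 < N) (x : Roof N s i) :
    (retr k hi x).side = if x.level = i + 1 then 0 else x.side := rfl

lemma level_ne (h₀ : ¬ s i) (x : DoubledChain N s) (hx : x.side ≠ 0) : x.level ≠ i := by
  rintro rfl
  have := x.side_eq
  simp_all

lemma retr_upperEmb_sect (h₀ : ¬ s i) (h₁ : ¬ s (i + 1)) (hi : i + 1 < N) (k : ℕ) (hk : k ≤ 1)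
    (x : DoubledChain N s) : retr k hi (upperEmb h₀ h₁ (sect k hk x)) = x := by
  have := level_ne h₀ x
  have := level_ne h₁ x
  rw [eq_iff]
  simp only [retr_level, retr_side, upperEmb_level, upperEmb_side, sect_level, sect_side]
  grind

lemma retr_lowerEmb_sect (h₀ : ¬ s i) (h₁ : ¬ s (i + 1)) (hi : i + 1 < N) (k l : ℕ) (hl : l ≤ 1)
    (hk : k + l = 1) (x : DoubledChain N s) : retr k hi (lowerEmb h₀ h₁ (sect l hl x)) = x := by
  have := level_ne h₀ x
  have := level_ne h₁ x
  rw [eq_iff]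
  simp only [retr_level, retr_side, lowerEmb_level, lowerEmb_side, sect_level, sect_side]
  grind

lemma gc_upper (h₀ : ¬ s i) (h₁ : ¬ s (i + 1)) (hi : i + 1 < N) (k : ℕ) (hk : k ≤ 1) :
    GaloisConnection (fun x => upperEmb h₀ h₁ (sect k hk x)) (retr k hi) := fun x y => by
  have := level_ne h₀ x
  have := level_ne h₁ x
  have := y.side_eq
  have := x.side_eq
  have hy : y.side = 1 → y.level ≠ i ∧ y.level ≠ i + 2 := by omega
  rw [le_def, le_def]
  simp only [retr_level, retr_side, upperEmb_level, upperEmb_side, sect_level, sect_side]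
  grind

lemma gc_lower (h₀ : ¬ s i) (h₁ : ¬ s (i + 1)) (hi : i + 1 < N) (k l : ℕ) (hl : l ≤ 1)
    (hk : k + l = 1) :
    GaloisConnection (retr k hi) (fun x => lowerEmb h₀ h₁ (sect l hl x)) := fun y x => by
  have := level_ne h₀ x
  have := level_ne h₁ x
  have := y.side_eq
  have := x.side_eq
  have hy : y.side = 1 → y.level ≠ i ∧ y.level ≠ i + 2 := by omega
  rw [le_def, le_def]
  simp only [retr_level, retr_side, lowerEmb_level, lowerEmb_side, sect_level, sect_side]
  grind

end Slide

end DoubledChain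

end DoubledChains

section Models

open DerivedCategory

variable {C : Type u} [Category.{v} C] [Abelian C]

/-- Extension by zero along an embedding of partially ordered sets whose image is an upper
set: the extended diagrams vanish outside of the image. -/
lemma DerivedCategory.ModelsVanishing.of_orderEmbedding [HasColimits C]
    {J K : Type} [PartialOrder J] [PartialOrder K] (j : J ↪o K)
    {E : Type*} [Category* E] [Abelian E] [HasDerivedCategory E]
    [HasDerivedCategory (J ⥤ C)] [HasDerivedCategory (K ⥤ C)] {V : Set J} {V' : Set K}
    (h : ModelsVanishing (C := C) E V)
    (hj : ∀ p, (∃ x, j x = p ∧ (p ∈ V' ↔ x ∈ V)) ∨ ((∀ x, ¬ j x ≤ p) ∧ p ∈ V')) :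
    ModelsVanishing (C := C) E V' :=
  h.of_cosieve j.monotone.functor fun p => (hj p).imp
    (fun ⟨x, hx, hx'⟩ => ⟨⟨x, hx⟩, fun _ hy => j.injective (hx.trans hy.symm) ▸ hx'⟩)
    (fun ⟨hp, hp'⟩ => ⟨⟨fun f => hp f.left (leOfHom f.hom)⟩, hp'⟩)

/-- An endofunctor of a partially ordered set which fixes all objects is isomorphic to the
identity. -/
def isoIdOfEq {J : Type*} [PartialOrder J] (F : J ⥤ J) (h : ∀ x, F.obj x = x) : F ≅ 𝟭 J :=
  NatIso.ofComponents (fun x => eqToIso (h x))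

namespace DoubledChain

variable {N : ℕ} {s : ℕ → Prop} {i : ℕ} {E : Type*} [Category* E] [Abelian E]
  [HasDerivedCategory E]

lemma gc_sect_retr_upperEmb (h₀ : ¬ s i) (h₁ : ¬ s (i + 1)) (hi : i + 1 < N) (k : ℕ)
    (hk : k ≤ 1) :
    GaloisConnection (sect (N := N) (s := s) k hk) (fun x => retr k hi (upperEmb h₀ h₁ x)) :=
  fun _ _ => by rw [← gc_upper h₀ h₁ hi k hk, (upperEmb h₀ h₁).le_iff_le]

lemma gc_retr_lowerEmb_sect (h₀ : ¬ s i) (h₁ : ¬ s (i + 1)) (hi : i + 1 < N) (k l : ℕ)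
    (hl : l ≤ 1) (hk : k + l = 1) :
    GaloisConnection (fun x => retr k hi (lowerEmb h₀ h₁ x)) (sect (N := N) (s := s) l hl) :=
  fun _ _ => by rw [gc_lower h₀ h₁ hi k l hl hk, (lowerEmb h₀ h₁).le_iff_le]

lemma exists_sect_eq (k : ℕ) (hk : k ≤ 1) (a : Insert N s i) (h : a.level = i → a.side = k) :
    ∃ x : DoubledChain N s, sect k hk x = a := by
  refine ⟨⟨a.level, if a.level = i then 0 else a.side, a.level_lt, ?_⟩, ?_⟩
  · have := a.side_eq
    split_ifs <;> simp_all
  · rw [eq_iff]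
    simp only [sect_level, sect_side]
    grind

lemma modelsVanishing_slide (h₀ : ¬ s i) (h₁ : ¬ s (i + 1)) (hi : i + 1 < N)
    [HasDerivedCategory (Insert N s i ⥤ C)] [HasDerivedCategory (Insert N s (i + 1) ⥤ C)]
    (h : ModelsVanishing (C := C) E {x : Insert N s i | x.side = 1}) :
    ModelsVanishing (C := C) E {x : Insert N s (i + 1) | x.side = 1} := by
  let _ := HasDerivedCategory.standard (Roof N s i ⥤ C)
  let _ := HasDerivedCategory.standard (DoubledChain N s ⥤ C)
  let k : Bool → ℕ := fun τ => τ.toNat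
  let l : Bool → ℕ := fun τ => (!τ).toNat
  have hk (τ) : k τ ≤ 1 := by cases τ <;> decide
  have hl (τ) : l τ ≤ 1 := by cases τ <;> decide
  have hkl (τ) : k τ + l τ = 1 := by cases τ <;> decide
  refine h.of_roof (upperEmb h₀ h₁).monotone.functor (lowerEmb h₀ h₁).monotone.functor
    (fun τ => (retr (k τ) hi).monotone.functor)
    (fun τ => (sect (k τ) (hk τ)).monotone.functor)
    (fun τ => (sect (l τ) (hl τ)).monotone.functor)
    (fun τ => (gc_upper h₀ h₁ hi (k τ) (hk τ)).adjunction)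
    (fun τ => (gc_sect_retr_upperEmb h₀ h₁ hi (k τ) (hk τ)).adjunction)
    (fun τ => isoIdOfEq _ (retr_upperEmb_sect h₀ h₁ hi (k τ) (hk τ)))
    (fun τ => (gc_lower h₀ h₁ hi (k τ) (l τ) (hl τ) (hkl τ)).adjunction)
    (fun τ => (gc_retr_lowerEmb_sect h₀ h₁ hi (k τ) (l τ) (hl τ) (hkl τ)).adjunction)
    (fun τ => isoIdOfEq _ (retr_lowerEmb_sect h₀ h₁ hi (k τ) (l τ) (hl τ) (hkl τ)))
    (fun a => ?_) (fun b => ?_) ?_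
  · by_cases ha : a.level = i + 1 → a.side = 1
    · exact Or.inl (exists_sect_eq _ _ a ha)
    · have := a.side_eq
      refine Or.inr ⟨exists_sect_eq _ _ a ?_, exists_sect_eq _ _ _ ?_⟩
      · change _ → _ = 0
        omega
      · change (sect 1 (hk true) (retr 1 hi (upperEmb h₀ h₁ a))).level = i + 1 → _
        simp only [sect_level, retr_level, upperEmb_level, upperEmb_side]
        grind
  · by_cases hb : b.level = i → b.side = 0
    · exact Or.inl (exists_sect_eq _ _ b hb)
    · have := b.side_eq
      refine Or.inr ⟨exists_sect_eq _ _ b ?_, exists_sect_eq _ _ _ ?_⟩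
      · change _ → _ = 1
        omega
      · change (sect 0 (hl true) (retr 1 hi (lowerEmb h₀ h₁ b))).level = i → _
        simp only [sect_level, retr_level, lowerEmb_level, lowerEmb_side]
        grind
  · have hα (x : Insert N s (i + 1)) :
        (upperEmb h₀ h₁).monotone.functor.obj x = upperEmb h₀ h₁ x := rfl
    have hβ (x : Insert N s i) :
        (lowerEmb h₀ h₁).monotone.functor.obj x = lowerEmb h₀ h₁ x := rfl
    ext y
    constructor
    · rintro ⟨x, hx : x.side = 1, rfl⟩
      have := x.side_eq
      have := x.level_lt
      refine ⟨⟨if x.level = i + 1 then i else x.level, 1, by grind, by grind⟩, rfl, ?_⟩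
      rw [hα, hβ, eq_iff, upperEmb_level, lowerEmb_level, upperEmb_side, lowerEmb_side]
      grind
    · rintro ⟨x, hx : x.side = 1, rfl⟩
      have := x.side_eq
      have := x.level_lt
      refine ⟨⟨if x.level = i then i + 1 else x.level, 1, by grind, by grind⟩, rfl, ?_⟩
      rw [hα, hβ, eq_iff, upperEmb_level, lowerEmb_level, upperEmb_side, lowerEmb_side]
      grind

/-- The derived category of the chain of length `N` models the derived diagrams on the doubled
chain which vanish on one side. -/
def HasModel (C : Type u) [Category.{v} C] [Abelian C] (E : Type*) [Category* E] [Abelian E]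
    [HasDerivedCategory E] (N : ℕ) (s : ℕ → Prop) : Prop :=
  let _ := HasDerivedCategory.standard (DoubledChain N s ⥤ C)
  ModelsVanishing (C := C) E {x : DoubledChain N s | x.side = 1}

lemma hasModel_or_eq [HasColimits C] (i : ℕ) (hi : i < N) (hs : ∀ j, s j → i < j)
    (h : HasModel C E N s) :
    HasModel C E N (fun j => s j ∨ j = i) := by
  let _ := HasDerivedCategory.standard (DoubledChain N s ⥤ C)
  induction i with
  | zero =>
    let _ := HasDerivedCategory.standard (Insert N s 0 ⥤ C)
    refine ModelsVanishing.of_orderEmbedding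
      (reindex id strictMono_id (fun _ => id) fun _ => Or.inl) h fun p => ?_
    by_cases hp : p.level = 0 ∧ p.side = 1
    · refine Or.inr ⟨fun x hx => ?_, hp.2⟩
      have := level_ne (fun h => (hs 0 h).false) x
      change x.level < p.level ∨ x.level = p.level ∧ x.side = p.side at hx
      omega
    · have := p.side_eq
      exact Or.inl ⟨⟨p.level, p.side, p.level_lt, by grind⟩, rfl, Iff.rfl⟩
  | succ i ih =>
    let _ := HasDerivedCategory.standard (Insert N s i ⥤ C)
    let _ := HasDerivedCategory.standard (Insert N s (i + 1) ⥤ C)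
    exact modelsVanishing_slide (fun h => by have := hs _ h; omega) (fun h => (hs _ h).false) hi
      (ih (by omega) fun j hj => by have := hs j hj; omega)

lemma hasModel_interval [HasColimits C] (N : ℕ) [HasDerivedCategory (Fin N ⥤ C)] (m : ℕ)
    (hm : m < N) :
    HasModel C (Fin N ⥤ C) N (fun j => N - 1 - m ≤ j ∧ j < N - 1) := by
  induction m with
  | zero =>
    let _ := HasDerivedCategory.standard
      (DoubledChain N (fun j => N - 1 - 0 ≤ j ∧ j < N - 1) ⥤ C)
    refine (modelsVanishing_self (C := C) (Fin N)).of_orderEmbedding (ofFin N _) fun p => ?_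
    have := p.side_eq
    have h : p.side = 0 := by omega
    exact Or.inl ⟨⟨p.level, p.level_lt⟩, DoubledChain.ext rfl h.symm, by simp [h]⟩
  | succ m ih =>
    convert hasModel_or_eq (N - 1 - (m + 1)) (by omega) (fun j hj => ?_) (ih (by omega)) using 2
      with j
    · omega
    · omega

lemma _root_.Atilde.le_iff {n : ℕ} (p q : Atilde n) :
    p ≤ q ↔ p.1.1.val ≤ q.1.1.val ∧ p.1.2.val ≤ q.1.2.val := Iff.rfl

/-- The poset `Ã(n,2)` as a doubled chain. -/
def toAtilde (n : ℕ) (hn : 3 ≤ n) :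
    DoubledChain n (fun j => n - 1 - (n - 2) ≤ j ∧ j < n - 1) ↪o Atilde n :=
  OrderEmbedding.ofMapLEIff
    (fun x => ⟨(⟨if x.level = n - 1 then n - 2 else if x.side = 1 then x.level - 1 else x.level,
        by have := x.level_lt; split_ifs <;> omega⟩,
      ⟨if x.level = 0 then 0 else if x.side = 1 then x.level else x.level - 1,
        by have := x.level_lt; have := x.side_eq; split_ifs <;> omega⟩), by
      have := x.level_lt
      have := x.side_eq
      grind⟩) fun a b => by
    have := a.level_lt
    have := a.side_eq
    have := b.level_lt
    have := b.side_eq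
    refine (Atilde.le_iff _ _).trans ?_
    rw [le_def]
    dsimp only
    grind

lemma exists_toAtilde_eq (n : ℕ) (hn : 3 ≤ n) (p : Atilde n) :
    ∃ x, toAtilde n hn x = p ∧ (p.1.1.val + 1 = p.1.2.val ↔ x.side = 1) := by
  obtain ⟨⟨⟨a, ha⟩, ⟨b, hb⟩⟩, hp⟩ := p
  dsimp only at hp
  refine ⟨⟨if a = n - 2 ∧ b = n - 2 then n - 1 else max a b,
    if a + 1 = b then 1 else 0, by grind, by grind⟩, ?_, by grind⟩
  refine Subtype.ext (Prod.ext (Fin.ext ?_) (Fin.ext ?_))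
  · change (if _ then _ else if _ then _ else _) = a
    grind
  · change (if _ then _ else if _ then _ else _) = b
    grind

end DoubledChain

end Models

/-- For a Grothendieck abelian category `C` (abelian, cocomplete with exact filtered
colimits, and with a separator) and `n ≥ 3`, the full subcategory of
`D(Fun(Ã(n,2), C))` spanned by the objects vanishing at every vanishing position
`(i, i+1)`, `0 ≤ i ≤ n-3`, is equivalent to `D(Fun([n-1], C))` via a triangulated
equivalence: there is a fully faithful triangulated functor from `D(Fun([n-1], C))`
whose essential image is exactly that subcategory. -/
theorem vanishing_subcategory_triangulated_equivalence
    (C : Type u) [Category.{v} C] [Abelian C] [HasColimits C] [AB5 C] [HasSeparator C]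
    (n : ℕ) (hn : 3 ≤ n)
    [HasDerivedCategory (Fin n ⥤ C)] [HasDerivedCategory (Atilde n ⥤ C)] :
    ∃ (F : DerivedCategory (Fin n ⥤ C) ⥤ DerivedCategory (Atilde n ⥤ C))
      (hc : F.CommShift ℤ),
      (letI := hc
       F.IsTriangulated) ∧ F.Full ∧ F.Faithful ∧
      ∀ X : DerivedCategory (Atilde n ⥤ C),
        (∃ Y, Nonempty (F.obj Y ≅ X)) ↔
          (∀ (i : ℕ) (hi : i + 2 < n) (q : ℤ),
            IsZero (((DerivedCategory.homologyFunctor (Atilde n ⥤ C) q).obj X).obj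
              ⟨(⟨i, by omega⟩, ⟨i + 1, by omega⟩), Or.inl (Or.inl rfl)⟩)) := by
  let _ := HasDerivedCategory.standard
    (DoubledChain n (fun j => n - 1 - (n - 2) ≤ j ∧ j < n - 1) ⥤ C)
  have h : DerivedCategory.ModelsVanishing (C := C) (Fin n ⥤ C)
      {p : Atilde n | p.1.1.val + 1 = p.1.2.val} :=
    (DoubledChain.hasModel_interval n (n - 2) (by omega)).of_orderEmbedding
      (DoubledChain.toAtilde n hn) fun p => Or.inl (DoubledChain.exists_toAtilde_eq n hn p)
  obtain ⟨F, hc, h₁, h₂, h₃, h₄⟩ := h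
  refine ⟨F, hc, h₁, h₂, h₃, fun X => (h₄ X).trans ⟨fun h i hi => h _ rfl, fun h p hp => ?_⟩⟩
  obtain ⟨⟨⟨i, hi⟩, ⟨j, hj⟩⟩, hp'⟩ := p
  obtain rfl : i + 1 = j := hp
  exact h i (by omega)
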